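/- arXiv:1202.1205 — 3 statements merged into one kernel-verified Lean document; each statement's English description precedes it below -/
import Mathlib

section
/- For every positive integer n and every real number x with sin x ≠ 0, the (2n-1)-th derivative of the cotangent function at x equals (1/sin^{2n} x) · Σ_{i=0}^{n-1} (-1)^{i+1} · a_{2n-1,2i} · cos(2 i x), where the coefficients a_{2n-1,2i} are given by the explicit formulas in the context. -/
open Finset

/-- The real cotangent function `cot x = cos x / sin x`. -/
noncomputable def cot (x : ℝ) : ℝ := Real.cos x / Real.sin x

/-- The coefficients `a_{2n-1,2i}` in the expansion of the `(2n-1)`-th derivative of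
the tangent function: `a_{1,0} = 1`;
`a_{2n-1,0} = 2n · Σ_{ℓ=0}^{n-2} (-1)^ℓ C(2n-1,ℓ) (n-ℓ-1)^{2n-2}` for `n > 1`;
`a_{2n-1,2i} = 2 · Σ_{ℓ=0}^{n-i-1} (-1)^{i+ℓ} C(2n,ℓ) (n-i-ℓ)^{2n-1}` for `1 ≤ i ≤ n-1`. -/
noncomputable def aodd (n i : ℕ) : ℝ :=
  if i = 0 then
    if n = 1 then 1
    else 2 * n * ∑ l ∈ Finset.range (n - 1),
      (-1 : ℝ) ^ l * (Nat.choose (2 * n - 1) l : ℝ) * ((n : ℝ) - l - 1) ^ (2 * n - 2)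
  else 2 * ∑ l ∈ Finset.range (n - i),
    (-1 : ℝ) ^ (i + l) * (Nat.choose (2 * n) l : ℝ) * ((n : ℝ) - i - l) ^ (2 * n - 1)

/-- The Eulerian numbers, as reals, indexed so that `eulerian m k` is supported on `1 ≤ k ≤ m`
for `m ≥ 1`. -/
noncomputable def eulerian : ℕ → ℕ → ℝ
  | 0, 0 => 1
  | 0, _ + 1 => 0
  | _ + 1, 0 => 0
  | m + 1, k + 1 => ((k : ℝ) + 1) * eulerian m (k + 1) + ((m : ℝ) + 1 - k) * eulerian m k

theorem eulerian_succ_zero (m : ℕ) : eulerian (m + 1) 0 = 0 := by rw [eulerian]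

theorem eulerian_succ_succ (m k : ℕ) : eulerian (m + 1) (k + 1) =
    ((k : ℝ) + 1) * eulerian m (k + 1) + ((m : ℝ) + 1 - k) * eulerian m k := by rw [eulerian]

theorem eulerian_eq_zero_of_lt {m k : ℕ} (h : m < k) : eulerian m k = 0 := by
  induction m generalizing k with
  | zero =>
    obtain ⟨k, rfl⟩ := Nat.exists_eq_add_of_lt h
    rw [zero_add, eulerian]
  | succ m ih =>
    obtain ⟨k, rfl⟩ : ∃ j, k = j + 1 := ⟨k - 1, by omega⟩
    rw [eulerian_succ_succ, ih (by omega), ih (by omega)]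
    ring

theorem eulerian_symm {m j k : ℕ} (h : j + k = m + 2) :
    eulerian (m + 1) j = eulerian (m + 1) k := by
  induction m generalizing j k with
  | zero =>
    obtain ⟨rfl, rfl⟩ | ⟨rfl, rfl⟩ | ⟨rfl, rfl⟩ :
        j = 0 ∧ k = 2 ∨ j = 1 ∧ k = 1 ∨ j = 2 ∧ k = 0 := by omega
    all_goals simp [eulerian]
  | succ m ih =>
    rcases j with _ | j
    · rw [eulerian_succ_zero, eulerian_eq_zero_of_lt (by omega)]
    rcases k with _ | k
    · rw [eulerian_succ_zero, eulerian_eq_zero_of_lt (by omega)]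
    rw [eulerian_succ_succ (m + 1), eulerian_succ_succ (m + 1), ih (show j + 1 + k = m + 2 by omega),
      ih (show j + (k + 1) = m + 2 by omega)]
    have h' : (j : ℝ) + k = m + 1 := by exact_mod_cast (show j + k = m + 1 by omega)
    push_cast
    rw [show (j : ℝ) = m + 1 - k by linarith]
    ring

/-- The alternating sum formula for the Eulerian numbers. -/
theorem eulerian_eq_sum (m k : ℕ) : eulerian m k =
    ∑ l ∈ range (k + 1), (-1 : ℝ) ^ l * ((m + 1).choose l : ℝ) * ((k : ℝ) - l) ^ m := by
  induction m generalizing k with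
  | zero =>
    rcases k with _ | k
    · simp [eulerian]
    · rw [sum_range_succ', sum_range_succ']
      simp [eulerian, Nat.choose_eq_zero_of_lt]
  | succ m ih =>
    rcases k with _ | k
    · simp [eulerian]
    rw [eulerian_succ_succ, ih, ih, sum_range_succ', sum_range_succ' _ (k + 1), mul_add, mul_sum,
      mul_sum, add_right_comm, ← sum_add_distrib]
    congr 1
    · refine sum_congr rfl fun l _ => ?_
      have h : ((m + 1).choose (l + 1) : ℝ) * (l + 1) = (m + 1).choose l * ((m : ℝ) + 1 - l) := by
        rcases le_or_gt l (m + 1) with hl | hl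
        · have := Nat.choose_succ_right_eq (m + 1) l
          rw [← Nat.cast_inj (R := ℝ)] at this
          push_cast [Nat.cast_sub hl] at this
          exact this
        · simp [Nat.choose_eq_zero_of_lt hl, Nat.choose_eq_zero_of_lt (hl.trans (Nat.lt_succ_self l))]
      rw [Nat.choose_succ_succ (m + 1) l, pow_succ _ m]
      push_cast
      rw [show (k : ℝ) + 1 - (l + 1) = k - l by ring]
      linear_combination (-1 : ℝ) ^ (l + 1) * ((k : ℝ) - l) ^ m * h
    · simp
      ring

/-- The numerator of the `m`-th derivative of the cotangent, up to sign. -/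
theorem sum_eulerian_mul_cos_succ (m : ℕ) (x : ℝ) :
    ∑ k ∈ range (m + 2), eulerian (m + 1) k * Real.cos ((2 * k - (m + 1 : ℕ) - 1) * x) =
      ∑ k ∈ range (m + 1), eulerian m k *
        ((2 * k - m - 1) * Real.sin ((2 * k - m - 1) * x) * Real.sin x +
          (m + 1) * (Real.cos ((2 * k - m - 1) * x) * Real.cos x)) := by
  rw [sum_range_succ', eulerian_succ_zero, zero_mul, add_zero]
  have hshift : ∑ k ∈ range (m + 1), ((k : ℝ) + 1) * eulerian m (k + 1) *
        Real.cos ((2 * (k + 1) - m - 2) * x) =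
      ∑ k ∈ range (m + 1), (k : ℝ) * eulerian m k * Real.cos ((2 * k - m - 2) * x) := by
    have h := (sum_range_succ' (fun k : ℕ =>
      (k : ℝ) * eulerian m k * Real.cos ((2 * k - m - 2) * x)) (m + 1)).symm
    rw [sum_range_succ _ (m + 1), eulerian_eq_zero_of_lt (Nat.lt_succ_self m)] at h
    simpa using h
  calc _ = ∑ k ∈ range (m + 1), ((k : ℝ) + 1) * eulerian m (k + 1) *
          Real.cos ((2 * (k + 1) - m - 2) * x) +
        ∑ k ∈ range (m + 1), ((m : ℝ) + 1 - k) * eulerian m k * Real.cos ((2 * k - m) * x) := by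
        rw [← sum_add_distrib]
        refine sum_congr rfl fun k _ => ?_
        rw [eulerian_succ_succ]
        push_cast
        rw [show (2 * ((k : ℝ) + 1) - (m + 1) - 1) = 2 * k - m by ring,
          show (2 * ((k : ℝ) + 1) - m - 2) = 2 * k - m by ring]
        ring
    _ = _ := by
        rw [hshift, ← sum_add_distrib]
        refine sum_congr rfl fun k _ => ?_
        rw [show (2 * (k : ℝ) - m - 2) * x = (2 * k - m - 1) * x - x by ring,
          show (2 * (k : ℝ) - m) * x = (2 * k - m - 1) * x + x by ring,
          Real.cos_sub, Real.cos_add]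
        ring

theorem iteratedDeriv_cot (m : ℕ) {x : ℝ} (hx : Real.sin x ≠ 0) :
    iteratedDeriv m cot x = (-1) ^ m *
      (∑ k ∈ range (m + 1), eulerian m k * Real.cos ((2 * k - m - 1) * x)) /
        Real.sin x ^ (m + 1) := by
  induction m generalizing x with
  | zero => simp [eulerian, cot]
  | succ m ih =>
    have hev : iteratedDeriv m cot =ᶠ[nhds x] fun y => (-1) ^ m *
        (∑ k ∈ range (m + 1), eulerian m k * Real.cos ((2 * k - m - 1) * y)) /
          Real.sin y ^ (m + 1) := by
      filter_upwards [Real.continuous_sin.continuousAt.eventually_ne hx] with y hy using ih hy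
    have hcos (k : ℕ) : HasDerivAt (fun y => eulerian m k * Real.cos ((2 * k - m - 1) * y))
        (eulerian m k * (-Real.sin ((2 * k - m - 1) * x) * (2 * k - m - 1))) x := by
      simpa using (((hasDerivAt_id x).const_mul (2 * (k : ℝ) - m - 1)).cos).const_mul
        (eulerian m k)
    have hder := ((HasDerivAt.fun_sum (u := range (m + 1)) fun k _ => hcos k).const_mul
      ((-1 : ℝ) ^ m)).div ((Real.hasDerivAt_sin x).pow (m + 1)) (pow_ne_zero _ hx)
    rw [iteratedDeriv_succ, hev.deriv_eq]
    refine hder.deriv.trans ?_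
    rw [sum_eulerian_mul_cos_succ]
    simp only [mul_add, sum_add_distrib, Pi.pow_apply]
    have h1 : ∑ k ∈ range (m + 1), eulerian m k *
        ((2 * k - m - 1) * Real.sin ((2 * k - m - 1) * x) * Real.sin x) =
        -Real.sin x * ∑ k ∈ range (m + 1),
          eulerian m k * (-Real.sin ((2 * k - m - 1) * x) * (2 * k - m - 1)) := by
      rw [mul_sum]
      exact sum_congr rfl fun k _ => by ring
    have h2 : ∑ k ∈ range (m + 1), eulerian m k *
        ((m + 1) * (Real.cos ((2 * k - m - 1) * x) * Real.cos x)) =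
        (m + 1) * Real.cos x * ∑ k ∈ range (m + 1),
          eulerian m k * Real.cos ((2 * k - m - 1) * x) := by
      rw [mul_sum]
      exact sum_congr rfl fun k _ => by ring
    rw [h1, h2]
    generalize ∑ k ∈ range (m + 1), eulerian m k * Real.cos ((2 * k - m - 1) * x) = C
    generalize ∑ k ∈ range (m + 1),
      eulerian m k * (-Real.sin ((2 * k - m - 1) * x) * (2 * k - m - 1)) = S
    rw [Nat.add_sub_cancel]
    push_cast
    field_simp
    ring

theorem aodd_zero (p : ℕ) : aodd (p + 1) 0 = eulerian (2 * p + 1) (p + 1) := by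
  rcases p with _ | p
  · simp [aodd, eulerian]
  have hs : eulerian (2 * p + 1 + 1) (p + 1 + 1) = eulerian (2 * p + 1 + 1) (p + 1) :=
    eulerian_symm (by omega)
  rw [show 2 * (p + 1) + 1 = 2 * p + 1 + 1 + 1 by ring, eulerian_succ_succ, hs, eulerian_eq_sum,
    sum_range_succ]
  simp only [aodd, if_true]
  rw [if_neg (by omega)]
  rw [show 2 * (p + 1 + 1) - 1 = 2 * p + 1 + 1 + 1 by omega,
    show 2 * (p + 1 + 1) - 2 = 2 * p + 1 + 1 by omega, show p + 1 + 1 - 1 = p + 1 by omega]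
  have hsum : ∑ l ∈ range (p + 1), (-1 : ℝ) ^ l * ((2 * p + 1 + 1 + 1).choose l : ℝ) *
      (((p + 1 + 1 : ℕ) : ℝ) - l - 1) ^ (2 * p + 1 + 1) =
      ∑ l ∈ range (p + 1), (-1 : ℝ) ^ l * ((2 * p + 1 + 1 + 1).choose l : ℝ) *
      (((p + 1 : ℕ) : ℝ) - l) ^ (2 * p + 1 + 1) :=
    sum_congr rfl fun l _ => by
      congr 2
      push_cast
      ring
  rw [hsum, sub_self, zero_pow (by omega)]
  push_cast
  ring

theorem aodd_of_pos {n i : ℕ} (hi : 0 < i) (hin : i < n) :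
    aodd n i = 2 * (-1) ^ i * eulerian (2 * n - 1) (n - i) := by
  rw [aodd, if_neg hi.ne', eulerian_eq_sum, sum_range_succ, sub_self, zero_pow (by omega),
    mul_zero, add_zero, mul_assoc, mul_sum _ _ ((-1 : ℝ) ^ i),
    show 2 * n - 1 + 1 = 2 * n by omega, Nat.cast_sub hin.le]
  exact congrArg _ (sum_congr rfl fun l _ => by ring)

theorem sum_range_eq_center_add_pairs {M : Type*} [AddCommMonoid M] (f : ℕ → M) (p : ℕ) :
    ∑ k ∈ range (2 * p + 1), f k =
      f p + ∑ j ∈ range p, (f (p - 1 - j) + f (p + (j + 1))) := by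
  rw [show 2 * p + 1 = p + (p + 1) by ring, sum_range_add, sum_range_succ' _ p, sum_add_distrib,
    sum_range_reflect, add_zero, ← add_assoc, add_comm]

theorem cot_iteratedDeriv_odd (n : ℕ) (hn : 1 ≤ n) (x : ℝ) (hx : Real.sin x ≠ 0) :
    iteratedDeriv (2 * n - 1) cot x =
      (1 / Real.sin x ^ (2 * n)) *
        ∑ i ∈ Finset.range n, (-1 : ℝ) ^ (i + 1) * aodd n i * Real.cos (2 * (i : ℝ) * x) := by
  obtain ⟨p, rfl⟩ : ∃ p, n = p + 1 := ⟨n - 1, by omega⟩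
  rw [show 2 * (p + 1) - 1 = 2 * p + 1 by omega, iteratedDeriv_cot _ hx, sum_range_succ',
    eulerian_succ_zero, zero_mul, add_zero, sum_range_eq_center_add_pairs,
    sum_range_succ' _ p, aodd_zero]
  have hterm : ∀ j ∈ range p,
      (-1 : ℝ) ^ (j + 1 + 1) * aodd (p + 1) (j + 1) * Real.cos (2 * ((j + 1 : ℕ) : ℝ) * x) =
      -(eulerian (2 * p + 1) (p - 1 - j + 1) *
          Real.cos ((2 * ((p - 1 - j + 1 : ℕ) : ℝ) - (2 * p + 1 : ℕ) - 1) * x) +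
        eulerian (2 * p + 1) (p + (j + 1) + 1) *
          Real.cos ((2 * ((p + (j + 1) + 1 : ℕ) : ℝ) - (2 * p + 1 : ℕ) - 1) * x)) := by
    intro j hj
    rw [mem_range] at hj
    rw [aodd_of_pos (by omega) (by omega), show p - 1 - j + 1 = p - j by omega,
      show 2 * (p + 1) - 1 = 2 * p + 1 by omega, show p + 1 - (j + 1) = p - j by omega,
      eulerian_symm (show p + (j + 1) + 1 + (p - j) = 2 * p + 2 by omega),
      Nat.cast_sub hj.le, ← Real.cos_neg ((2 * ((p : ℝ) - j) - (2 * p + 1 : ℕ) - 1) * x)]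
    push_cast
    rw [show -((2 * ((p : ℝ) - j) - (2 * p + 1) - 1) * x) = 2 * (j + 1) * x by ring,
      show (2 * ((p : ℝ) + (j + 1) + 1) - (2 * p + 1) - 1) * x = 2 * (j + 1) * x by ring]
    have hsq : (-1 : ℝ) ^ j * (-1) ^ j = 1 := by rw [← mul_pow]; simp
    linear_combination (-2 * eulerian (2 * p + 1) (p - j) * Real.cos (2 * (j + 1) * x)) * hsq
  rw [sum_congr rfl hterm, sum_neg_distrib, Odd.neg_one_pow ⟨p, rfl⟩,
    show 2 * (p + 1) = 2 * p + 1 + 1 by ring]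
  push_cast
  rw [show (2 * ((p : ℝ) + 1) - (2 * p + 1) - 1) * x = 0 by ring]
  simp only [mul_zero, zero_mul, Real.cos_zero]
  ring
end

section
/- For every positive integer n, the leading coefficient formula a_{2n+1,0} = (n+1) · a_{2n,1} holds in explicit form: 2·(n+1) · Σ_{ℓ=0}^{n-1} (-1)^ℓ · C(2n+1, ℓ) · (n-ℓ)^{2n} equals (n+1) times 2 · Σ_{ℓ=0}^{n-1} (-1)^ℓ · C(2n+1, ℓ) · (n-ℓ)^{2n}, and this common value equals the constant term a_{2n+1,0} in the expansion of the (2n+1)-th derivative of the tangent: for every real x with cos x ≠ 0, tan^{(2n+1)}(x) · cos^{2n+2} x - Σ_{i=1}^{n} a_{2n+1,2i} · cos(2 i x) = 2(n+1) · Σ_{ℓ=0}^{n-1} (-1)^ℓ · C(2n+1, ℓ) · (n-ℓ)^{2n}, where a_{2n+1,2i} = 2 · Σ_{ℓ=0}^{n-i} (-1)^{i+ℓ} · C(2n+2, ℓ) · (n-i-ℓ+1)^{2n+1} for 1 ≤ i ≤ n. -/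
open Finset

/-- The Eulerian numbers: `eulerianNumber k m` is the number of permutations of `k + 1` letters
with exactly `m` descents, as a real number. -/
def eulerianNumber : ℕ → ℕ → ℝ
  | 0, 0 => 1
  | 0, _ + 1 => 0
  | k + 1, 0 => eulerianNumber k 0
  | k + 1, m + 1 =>
      ((m : ℝ) + 2) * eulerianNumber k (m + 1) + ((k : ℝ) + 1 - m) * eulerianNumber k m

namespace eulerianNumber

theorem succ_zero (k : ℕ) : eulerianNumber (k + 1) 0 = eulerianNumber k 0 := by
  rw [eulerianNumber]

theorem succ_succ (k m : ℕ) : eulerianNumber (k + 1) (m + 1) =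
    ((m : ℝ) + 2) * eulerianNumber k (m + 1) + ((k : ℝ) + 1 - m) * eulerianNumber k m := by
  rw [eulerianNumber]

theorem zero_right (k : ℕ) : eulerianNumber k 0 = 1 := by
  induction k with
  | zero => rw [eulerianNumber]
  | succ k ih => rw [succ_zero, ih]

theorem eq_zero_of_lt {k m : ℕ} (h : k < m) : eulerianNumber k m = 0 := by
  induction k generalizing m with
  | zero =>
    obtain ⟨m, rfl⟩ := Nat.exists_eq_succ_of_ne_zero h.ne'
    rw [eulerianNumber]
  | succ k ih =>
    obtain ⟨m, rfl⟩ := Nat.exists_eq_succ_of_ne_zero (Nat.ne_zero_of_lt h)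
    rw [Nat.succ_eq_add_one, succ_succ, ih (by lia), ih (by lia)]
    simp

theorem symm_of_add_eq {k m m' : ℕ} (h : m + m' = k) :
    eulerianNumber k m = eulerianNumber k m' := by
  induction k generalizing m m' with
  | zero =>
    obtain ⟨rfl, rfl⟩ : m = 0 ∧ m' = 0 := by lia
    rfl
  | succ k ih =>
    have boundary (k : ℕ) : eulerianNumber k k = 1 := by
      induction k with
      | zero => exact zero_right 0
      | succ k ihk => rw [succ_succ, eq_zero_of_lt (Nat.lt_succ_self k), ihk]; ring
    rcases m with _ | m
    · obtain rfl : m' = k + 1 := by lia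
      rw [zero_right, boundary]
    rcases m' with _ | m'
    · obtain rfl : m = k := by lia
      rw [zero_right, boundary]
    have hk : k = m + m' + 1 := by lia
    have hk' : (k : ℝ) = m + m' + 1 := by exact_mod_cast hk
    rw [succ_succ, succ_succ, ih (m := m + 1) (m' := m') (by lia),
      ih (m := m) (m' := m' + 1) (by lia), hk']
    ring

/-- The explicit alternating-sum formula for Eulerian numbers. -/
theorem eq_sum (k m : ℕ) : eulerianNumber k m =
    ∑ l ∈ range (m + 1),
      (-1 : ℝ) ^ l * (Nat.choose (k + 2) l : ℝ) * ((m : ℝ) + 1 - l) ^ (k + 1) := by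
  induction k generalizing m with
  | zero =>
    rcases m with _ | _ | m
    · simp [eulerianNumber]
    · simp [eulerianNumber, sum_range_succ]
      norm_num
    · rw [eq_zero_of_lt (by lia), show m + 1 + 1 + 1 = 3 + m by lia, sum_range_add,
        sum_eq_zero (s := range m)]
      · simp [sum_range_succ]
        ring
      · intro l _
        rw [Nat.choose_eq_zero_of_lt (by lia)]
        simp
  | succ k ih =>
    rcases m with _ | m
    · simp [zero_right]
    rw [succ_succ, ih, ih, sum_range_succ', sum_range_succ' _ (m + 1), mul_add, mul_sum, mul_sum,
      add_right_comm, ← sum_add_distrib]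
    congr 1
    · refine sum_congr rfl fun l _ => ?_
      have pascal : (Nat.choose (k + 1 + 2) (l + 1) : ℝ) =
          Nat.choose (k + 2) l + Nat.choose (k + 2) (l + 1) := by
        exact_mod_cast Nat.choose_succ_succ (k + 2) l
      have absorb : (Nat.choose (k + 2) (l + 1) : ℝ) * (l + 1) =
          Nat.choose (k + 2) l * ((k : ℝ) + 2 - l) := by
        rcases le_or_gt l (k + 2) with hl | hl
        · have := Nat.choose_succ_right_eq (k + 2) l
          rw [← @Nat.cast_inj ℝ] at this
          push_cast [Nat.cast_sub hl] at this
          exact this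
        · rw [Nat.choose_eq_zero_of_lt hl, Nat.choose_eq_zero_of_lt (by lia)]
          simp
      rw [pascal]
      push_cast
      rw [show (m : ℝ) + 1 + 1 - (l + 1) = m + 1 - l by ring]
      linear_combination (-1 : ℝ) ^ l * ((m : ℝ) + 1 - l) ^ (k + 1) * (-absorb)
    · push_cast
      simp
      ring

end eulerianNumber

/-- The numerator of the `(k + 1)`-st derivative of the tangent over `cos x ^ (k + 2)`. -/
noncomputable def tanDerivNumerator (k : ℕ) (x : ℝ) : ℝ :=
  ∑ m ∈ range (k + 1), eulerianNumber k m * Real.cos ((2 * (m : ℝ) - k) * (x - Real.pi / 2))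

theorem hasDerivAt_tanDerivNumerator (k : ℕ) (x : ℝ) :
    HasDerivAt (tanDerivNumerator k)
      (∑ m ∈ range (k + 1), eulerianNumber k m *
        (-Real.sin ((2 * (m : ℝ) - k) * (x - Real.pi / 2)) * (2 * (m : ℝ) - k))) x := by
  refine HasDerivAt.fun_sum fun m _ => HasDerivAt.const_mul _ (HasDerivAt.cos ?_)
  simpa using ((hasDerivAt_id x).sub_const (Real.pi / 2)).const_mul (2 * (m : ℝ) - k)

theorem tanDerivNumerator_succ (k : ℕ) (x : ℝ) :
    tanDerivNumerator (k + 1) x =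
      (∑ m ∈ range (k + 1), eulerianNumber k m *
        (-Real.sin ((2 * (m : ℝ) - k) * (x - Real.pi / 2)) * (2 * (m : ℝ) - k))) * Real.cos x
      + ((k : ℝ) + 2) * tanDerivNumerator k x * Real.sin x := by
  have hshift : ∑ m ∈ range (k + 1), eulerianNumber k m * ((m : ℝ) + 1) *
        Real.cos ((2 * (m : ℝ) - k - 1) * (x - Real.pi / 2)) =
      ∑ m ∈ range (k + 1), eulerianNumber k (m + 1) * ((m : ℝ) + 2) *
        Real.cos ((2 * (m : ℝ) + 1 - k) * (x - Real.pi / 2)) +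
      eulerianNumber k 0 * Real.cos ((-k - 1) * (x - Real.pi / 2)) := by
    have := sum_range_succ (fun m : ℕ => eulerianNumber k m * ((m : ℝ) + 1) *
        Real.cos ((2 * (m : ℝ) - k - 1) * (x - Real.pi / 2))) (k + 1)
    rw [eulerianNumber.eq_zero_of_lt (Nat.lt_succ_self k), zero_mul, zero_mul, add_zero] at this
    rw [← this, sum_range_succ']
    congr 1
    · refine sum_congr rfl fun m _ => ?_
      push_cast
      ring_nf
    · push_cast
      ring_nf
  have hterm (m : ℕ) : eulerianNumber k m *
        (-Real.sin ((2 * (m : ℝ) - k) * (x - Real.pi / 2)) * (2 * (m : ℝ) - k)) * Real.cos x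
      + ((k : ℝ) + 2) * (eulerianNumber k m *
        Real.cos ((2 * (m : ℝ) - k) * (x - Real.pi / 2))) * Real.sin x =
      eulerianNumber k m * ((m : ℝ) + 1) *
        Real.cos ((2 * (m : ℝ) - k - 1) * (x - Real.pi / 2)) +
      eulerianNumber k m * ((k : ℝ) + 1 - m) *
        Real.cos ((2 * (m : ℝ) + 1 - k) * (x - Real.pi / 2)) := by
    have hc : Real.cos x = -Real.sin (x - Real.pi / 2) := by rw [Real.sin_sub_pi_div_two, neg_neg]
    have hs : Real.sin x = Real.cos (x - Real.pi / 2) := (Real.cos_sub_pi_div_two x).symm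
    rw [hc, hs]
    generalize x - Real.pi / 2 = y
    rw [show (2 * (m : ℝ) - k - 1) * y = (2 * (m : ℝ) - k) * y - y by ring,
      show (2 * (m : ℝ) + 1 - k) * y = (2 * (m : ℝ) - k) * y + y by ring,
      Real.cos_sub, Real.cos_add]
    ring
  rw [tanDerivNumerator, tanDerivNumerator, sum_mul, mul_sum, sum_mul, ← sum_add_distrib,
    sum_congr rfl fun m _ => hterm m, sum_add_distrib, hshift, sum_range_succ',
    eulerianNumber.succ_zero, add_right_comm, ← sum_add_distrib]
  congr 1
  · refine sum_congr rfl fun m _ => ?_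
    rw [eulerianNumber.succ_succ]
    push_cast
    rw [show 2 * ((m : ℝ) + 1) - (k + 1) = 2 * m + 1 - k by ring]
    ring
  · push_cast
    ring_nf

theorem iteratedDeriv_succ_tan (k : ℕ) {x : ℝ} (hx : Real.cos x ≠ 0) :
    iteratedDeriv (k + 1) Real.tan x = tanDerivNumerator k x / Real.cos x ^ (k + 2) := by
  induction k generalizing x with
  | zero =>
    rw [zero_add, iteratedDeriv_one, Real.deriv_tan]
    simp [tanDerivNumerator, eulerianNumber.zero_right]
  | succ k ih =>
    have hev : iteratedDeriv (k + 1) Real.tan =ᶠ[nhds x]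
        fun y => tanDerivNumerator k y / Real.cos y ^ (k + 2) := by
      filter_upwards [Real.continuous_cos.continuousAt.eventually_ne hx] with y hy
      exact ih hy
    have hd := (hasDerivAt_tanDerivNumerator k x).fun_div
      ((Real.hasDerivAt_cos x).fun_pow (k + 2)) (pow_ne_zero _ hx)
    rw [iteratedDeriv_succ, hev.deriv_eq, hd.deriv, tanDerivNumerator_succ,
      div_eq_div_iff (by positivity) (by positivity)]
    push_cast
    ring

/-- The even-index numerators as cosine polynomials in `2 * x`. -/
theorem tanDerivNumerator_two_mul (n : ℕ) (x : ℝ) :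
    tanDerivNumerator (2 * n) x = eulerianNumber (2 * n) n +
      ∑ i ∈ Icc 1 n, 2 * ((-1) ^ i * eulerianNumber (2 * n) (n - i)) *
        Real.cos (2 * (i : ℝ) * x) := by
  have hcos (i : ℕ) : Real.cos (2 * (i : ℝ) * (x - Real.pi / 2)) =
      (-1) ^ i * Real.cos (2 * (i : ℝ) * x) := by
    rw [show 2 * (i : ℝ) * (x - Real.pi / 2) = 2 * i * x - i * Real.pi by ring,
      Real.cos_sub_nat_mul_pi]
  have hIcc : Icc 1 n = Ico (0 + 1) (n + 1) := by ext; simp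
  rw [tanDerivNumerator, show 2 * n + 1 = n + (n + 1) by lia, sum_range_add, sum_range_succ',
    ← sum_range_reflect, ← add_assoc, ← sum_add_distrib, add_comm, hIcc,
    ← sum_Ico_add', ← range_eq_Ico]
  congr 1
  · simp
  · refine sum_congr rfl fun j hj => ?_
    have hj : j + 1 ≤ n := mem_range.mp hj
    rw [show n - 1 - j = n - (j + 1) by lia,
      eulerianNumber.symm_of_add_eq (m := n + (j + 1)) (m' := n - (j + 1)) (by lia),
      Nat.cast_sub hj]
    have h₁ := hcos (j + 1)
    have h₂ := Real.cos_neg (2 * ((j + 1 : ℕ) : ℝ) * (x - Real.pi / 2))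
    rw [h₁] at h₂
    rw [show (2 * ((n : ℝ) - ((j + 1 : ℕ) : ℝ)) - ((2 * n : ℕ) : ℝ)) * (x - Real.pi / 2) =
        -(2 * ((j + 1 : ℕ) : ℝ) * (x - Real.pi / 2)) by push_cast; ring,
      show (2 * ((n + (j + 1) : ℕ) : ℝ) - ((2 * n : ℕ) : ℝ)) * (x - Real.pi / 2) =
        2 * ((j + 1 : ℕ) : ℝ) * (x - Real.pi / 2) by push_cast; ring, h₁, h₂]
    ring

theorem tan_deriv_constant_coeff (n : ℕ) (hn : 1 ≤ n) :
    (2 * ((n : ℝ) + 1) * ∑ l ∈ Finset.range n,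
        (-1 : ℝ) ^ l * (Nat.choose (2 * n + 1) l : ℝ) * ((n : ℝ) - l) ^ (2 * n)
      = ((n : ℝ) + 1) * (2 * ∑ l ∈ Finset.range n,
        (-1 : ℝ) ^ l * (Nat.choose (2 * n + 1) l : ℝ) * ((n : ℝ) - l) ^ (2 * n)))
    ∧ ∀ x : ℝ, Real.cos x ≠ 0 →
      iteratedDeriv (2 * n + 1) Real.tan x * Real.cos x ^ (2 * n + 2)
        - ∑ i ∈ Finset.Icc 1 n,
            (2 * ∑ l ∈ Finset.range (n - i + 1),
              (-1 : ℝ) ^ (i + l) * (Nat.choose (2 * n + 2) l : ℝ)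
                * ((n : ℝ) - i - l + 1) ^ (2 * n + 1)) * Real.cos (2 * (i : ℝ) * x)
      = 2 * ((n : ℝ) + 1) * ∑ l ∈ Finset.range n,
          (-1 : ℝ) ^ l * (Nat.choose (2 * n + 1) l : ℝ) * ((n : ℝ) - l) ^ (2 * n) := by
  refine ⟨by ring, fun x hx => ?_⟩
  have hconst : eulerianNumber (2 * n) n = 2 * ((n : ℝ) + 1) * ∑ l ∈ Finset.range n,
      (-1 : ℝ) ^ l * (Nat.choose (2 * n + 1) l : ℝ) * ((n : ℝ) - l) ^ (2 * n) := by
    obtain ⟨n, rfl⟩ := Nat.exists_eq_add_of_le' hn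
    rw [show 2 * (n + 1) = 2 * n + 1 + 1 by ring, eulerianNumber.succ_succ,
      eulerianNumber.symm_of_add_eq (m := n + 1) (m' := n) (by ring), eulerianNumber.eq_sum]
    push_cast
    ring
  rw [iteratedDeriv_succ_tan _ hx, div_mul_cancel₀ _ (pow_ne_zero _ hx),
    tanDerivNumerator_two_mul, hconst, sub_eq_iff_eq_add, add_right_inj]
  refine sum_congr rfl fun i hi => ?_
  rw [eulerianNumber.eq_sum, mul_sum, Nat.cast_sub (mem_Icc.mp hi).2]
  congr 2
  refine sum_congr rfl fun l _ => ?_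
  rw [pow_add]
  ring
end

section
/- For every positive integer n and every real number x with cos x ≠ 0, the (2n)-th derivative of the tangent function at x, multiplied by cos^{2n+1} x and with all lower-frequency terms subtracted, has leading coefficient (-1)^{n-1}·2; precisely, tan^{(2n)}(x) · cos^{2n+1} x - Σ_{i=0}^{n-2} a_{2n,2i+1} · sin((2i+1) x) = (-1)^{n-1} · 2 · sin((2n-1) x), where a_{2n,2i+1} = 2 · Σ_{ℓ=0}^{n-i-1} (-1)^{i+ℓ} · C(2n+1, ℓ) · (n-i-ℓ)^{2n}. -/
open Finset

/-- The Eulerian numbers, given by their alternating binomial sum. -/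
noncomputable def eulerianReal (m k : ℕ) : ℝ :=
  ∑ l ∈ range (k + 1), (-1 : ℝ) ^ l * (Nat.choose (m + 1) l : ℝ) * ((k : ℝ) - l) ^ m

/-- The numerator of the `m`-th derivative of `tan` over the denominator `cos ^ (m + 1)`. -/
noncomputable def tanNumerator (m : ℕ) (x : ℝ) : ℝ :=
  ∑ k ∈ range (m + 2), (-1 : ℝ) ^ k * eulerianReal m k *
    Real.sin ((2 * (k : ℝ) - m - 1) * x + ((m : ℝ) * (Real.pi / 2) + Real.pi))

lemma eulerianReal_succ_zero (m : ℕ) : eulerianReal (m + 1) 0 = 0 := by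
  simp [eulerianReal]

lemma eulerianReal_succ_succ (m k : ℕ) :
    eulerianReal (m + 1) (k + 1) =
      (k + 1) * eulerianReal m (k + 1) + ((m : ℝ) + 1 - k) * eulerianReal m k := by
  unfold eulerianReal
  rw [sum_range_succ' _ (k + 1), sum_range_succ' _ (k + 1), mul_sum,
    mul_add, mul_sum, add_right_comm (Finset.sum _ _), ← sum_add_distrib]
  congr 1
  · refine sum_congr rfl fun l _ => ?_
    have pascal : (Nat.choose (m + 1 + 1) (l + 1) : ℝ)
        = Nat.choose (m + 1) l + Nat.choose (m + 1) (l + 1) := by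
      exact_mod_cast Nat.choose_succ_succ (m + 1) l
    have absorb : ((l : ℝ) + 1) * Nat.choose (m + 1) (l + 1)
        = ((m : ℝ) + 1 - l) * Nat.choose (m + 1) l := by
      have h := Nat.add_one_mul_choose_eq (m + 1) l
      have h' : ((m : ℝ) + 1 + 1) * Nat.choose (m + 1) l
          = Nat.choose (m + 1 + 1) (l + 1) * ((l : ℝ) + 1) := by exact_mod_cast h
      rw [pascal] at h'
      linarith
    rw [pascal]
    push_cast
    rw [show (k : ℝ) + 1 - (l + 1) = k - l by ring]
    linear_combination ((-1 : ℝ) ^ l * ((k : ℝ) - l) ^ m) * absorb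
  · simp [pow_succ]
    ring

lemma eulerianReal_eq_zero {m k : ℕ} (h : m < k) : eulerianReal m k = 0 := by
  induction m generalizing k with
  | zero =>
    obtain ⟨k, rfl⟩ := Nat.exists_eq_add_of_lt h
    unfold eulerianReal
    rw [sum_range_succ', sum_range_succ']
    rw [sum_eq_zero]
    · simp
    · intro l _
      simp [Nat.choose_eq_zero_of_lt (show 1 < l + 1 + 1 by omega)]
  | succ m ih =>
    obtain ⟨k, rfl⟩ := Nat.exists_eq_succ_of_ne_zero (by omega : k ≠ 0)
    rw [Nat.succ_eq_add_one, eulerianReal_succ_succ, ih (by omega), ih (by omega)]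
    simp

lemma eulerianReal_symm {m p q : ℕ} (h : p + q = m + 2) :
    eulerianReal (m + 1) p = eulerianReal (m + 1) q := by
  induction m generalizing p q with
  | zero =>
    have : p = 0 ∧ q = 2 ∨ p = 1 ∧ q = 1 ∨ p = 2 ∧ q = 0 := by omega
    rcases this with ⟨rfl, rfl⟩ | ⟨rfl, rfl⟩ | ⟨rfl, rfl⟩
    · rw [eulerianReal_succ_zero, eulerianReal_eq_zero (by norm_num)]
    · rfl
    · rw [eulerianReal_succ_zero, eulerianReal_eq_zero (by norm_num)]
  | succ m ih =>
    rcases p with _ | p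
    · rw [eulerianReal_succ_zero, eulerianReal_eq_zero (by omega)]
    rcases q with _ | q
    · rw [eulerianReal_succ_zero, eulerianReal_eq_zero (by omega)]
    rw [eulerianReal_succ_succ (m + 1) p, eulerianReal_succ_succ (m + 1) q,
      ih (show p + 1 + q = m + 2 by omega),
      ih (show p + (q + 1) = m + 2 by omega)]
    have : (p : ℝ) + q = m + 1 := by exact_mod_cast (by omega : p + q = m + 1)
    push_cast
    rw [show (p : ℝ) = m + 1 - q by linarith]
    ring

lemma exists_hasDerivAt_tanNumerator (m : ℕ) (x : ℝ) :
    ∃ d, HasDerivAt (tanNumerator m) d x ∧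
      tanNumerator (m + 1) x = d * Real.cos x + (m + 1) * Real.sin x * tanNumerator m x := by
  have hd : HasDerivAt (tanNumerator m) (∑ k ∈ range (m + 2), (-1 : ℝ) ^ k * eulerianReal m k *
      (Real.cos ((2 * (k : ℝ) - m - 1) * x + ((m : ℝ) * (Real.pi / 2) + Real.pi)) *
        (2 * (k : ℝ) - m - 1))) x := by
    refine HasDerivAt.fun_sum fun k _ => ?_
    refine HasDerivAt.const_mul _ (HasDerivAt.sin ?_)
    simpa using ((hasDerivAt_id x).const_mul (2 * (k : ℝ) - m - 1)).add_const
      ((m : ℝ) * (Real.pi / 2) + Real.pi)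
  refine ⟨_, hd, ?_⟩
  set c : ℕ → ℝ := fun k =>
    Real.cos ((2 * (k : ℝ) - m - 2) * x + ((m : ℝ) * (Real.pi / 2) + Real.pi)) with hc
  have hsin (k : ℕ) : Real.sin ((2 * (k : ℝ) - (m + 1 : ℕ) - 1) * x
      + (((m + 1 : ℕ) : ℝ) * (Real.pi / 2) + Real.pi)) = c k := by
    simp only [hc, ← Real.sin_add_pi_div_two]
    push_cast
    ring_nf
  have hstep (k : ℕ) : Real.cos ((2 * (k : ℝ) - m - 1) * x + ((m : ℝ) * (Real.pi / 2) + Real.pi)) *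
        (2 * (k : ℝ) - m - 1) * Real.cos x + (m + 1) * Real.sin x *
        Real.sin ((2 * (k : ℝ) - m - 1) * x + ((m : ℝ) * (Real.pi / 2) + Real.pi))
      = k * c k - ((m : ℝ) + 1 - k) * c (k + 1) := by
    have h₁ : c k = Real.cos ((2 * (k : ℝ) - m - 1) * x
        + ((m : ℝ) * (Real.pi / 2) + Real.pi) - x) := by
      rw [hc]; ring_nf
    have h₂ : c (k + 1) = Real.cos ((2 * (k : ℝ) - m - 1) * x
        + ((m : ℝ) * (Real.pi / 2) + Real.pi) + x) := by
      rw [hc]; push_cast; ring_nf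
    rw [h₁, h₂, Real.cos_sub _ x, Real.cos_add _ x]
    ring
  have hshift : ∑ k ∈ range (m + 2), (-1 : ℝ) ^ (k + 1) * ((k : ℝ) + 1) *
        eulerianReal m (k + 1) * c (k + 1)
      = ∑ k ∈ range (m + 2), (-1 : ℝ) ^ k * k * eulerianReal m k * c k := by
    have h := sum_range_succ' (fun k : ℕ => (-1 : ℝ) ^ k * k * eulerianReal m k * c k) (m + 2)
    rw [sum_range_succ, eulerianReal_eq_zero (show m < m + 2 by omega)] at h
    simpa using h.symm
  have hnum : tanNumerator (m + 1) x = ∑ k ∈ range (m + 2),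
      (-1 : ℝ) ^ (k + 1) * eulerianReal (m + 1) (k + 1) * c (k + 1) := by
    unfold tanNumerator
    simp only [hsin]
    rw [sum_range_succ', eulerianReal_succ_zero]
    simp
  rw [hnum]
  calc _ = ∑ k ∈ range (m + 2), (-1 : ℝ) ^ (k + 1) * ((k : ℝ) + 1) *
          eulerianReal m (k + 1) * c (k + 1)
        + ∑ k ∈ range (m + 2), (-1 : ℝ) ^ (k + 1) * ((m : ℝ) + 1 - k) *
          eulerianReal m k * c (k + 1) := by
        rw [← sum_add_distrib]
        refine sum_congr rfl fun k _ => ?_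
        rw [eulerianReal_succ_succ]
        ring
    _ = _ := by
        rw [hshift, tanNumerator, sum_mul, mul_sum, ← sum_add_distrib, ← sum_add_distrib]
        refine sum_congr rfl fun k _ => ?_
        linear_combination (-(-1 : ℝ) ^ k * eulerianReal m k) * hstep k

lemma iteratedDeriv_tan (m : ℕ) {x : ℝ} (hx : Real.cos x ≠ 0) :
    iteratedDeriv m Real.tan x = tanNumerator m x / Real.cos x ^ (m + 1) := by
  induction m generalizing x with
  | zero =>
    simp [tanNumerator, sum_range_succ, eulerianReal, Real.tan_eq_sin_div_cos, Real.sin_add_pi]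
  | succ m ih =>
    have heq : iteratedDeriv m Real.tan =ᶠ[nhds x]
        fun y => tanNumerator m y / Real.cos y ^ (m + 1) := by
      filter_upwards [Real.continuous_cos.continuousAt.eventually_ne hx] with y hy using ih hy
    obtain ⟨d, hd, hrec⟩ := exists_hasDerivAt_tanNumerator m x
    rw [iteratedDeriv_succ, heq.deriv_eq, hrec,
      (hd.fun_div ((Real.hasDerivAt_cos x).fun_pow (m + 1)) (pow_ne_zero _ hx)).deriv]
    field_simp
    push_cast
    ring

lemma tanNumerator_two_mul (n : ℕ) (hn : 1 ≤ n) (x : ℝ) :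
    tanNumerator (2 * n) x = ∑ i ∈ range n,
      2 * ((-1 : ℝ) ^ i * eulerianReal (2 * n) (n - i)) * Real.sin ((2 * (i : ℝ) + 1) * x) := by
  obtain ⟨m, hm⟩ : ∃ m, 2 * n = m + 1 := ⟨2 * n - 1, by omega⟩
  have hphase (y : ℝ) : Real.sin (y + (((2 * n : ℕ) : ℝ) * (Real.pi / 2) + Real.pi))
      = (-1 : ℝ) ^ (n + 1) * Real.sin y := by
    rw [← Real.sin_add_nat_mul_pi]
    push_cast
    ring_nf
  have hlast : eulerianReal (2 * n) 0 = 0 := by rw [hm, eulerianReal_succ_zero]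
  unfold tanNumerator
  simp only [hphase]
  rw [show 2 * n + 2 = (n + 1) + (n + 1) by ring, sum_range_add,
    ← sum_range_reflect _ (n + 1), ← sum_add_distrib, sum_range_succ]
  rw [show n + 1 + n = 2 * n + 1 by ring, eulerianReal_eq_zero (show 2 * n < 2 * n + 1 by omega)]
  simp only [Nat.add_sub_cancel, Nat.sub_self, hlast, mul_zero, zero_mul, add_zero]
  refine sum_congr rfl fun i hi => ?_
  obtain ⟨j, rfl⟩ := Nat.exists_eq_add_of_lt (mem_range.mp hi)
  have hsymm : eulerianReal (2 * (i + j + 1)) (i + j + 1 + 1 + i)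
      = eulerianReal (2 * (i + j + 1)) (j + 1) := by
    rw [hm]
    exact eulerianReal_symm (by omega)
  rw [hsymm, show i + j + 1 - i = j + 1 by omega]
  push_cast
  rw [show (2 * ((j : ℝ) + 1) - 2 * (i + j + 1) - 1) * x = -((2 * i + 1) * x) by ring,
    Real.sin_neg,
    show (2 * ((i : ℝ) + j + 1 + 1 + i) - 2 * (i + j + 1) - 1) * x = (2 * i + 1) * x by ring]
  simp only [pow_add, pow_one]
  rcases neg_one_pow_eq_or ℝ i with hi' | hi' <;> rcases neg_one_pow_eq_or ℝ j with hj' | hj' <;>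
    rw [hi', hj'] <;> ring

lemma two_mul_eulerianReal_mid (n i : ℕ) (hi : i < n) :
    2 * ((-1 : ℝ) ^ i * eulerianReal (2 * n) (n - i)) =
      2 * ∑ l ∈ range (n - i), (-1 : ℝ) ^ (i + l) * (Nat.choose (2 * n + 1) l : ℝ)
        * ((n : ℝ) - i - l) ^ (2 * n) := by
  rw [eulerianReal, sum_range_succ, sub_self, zero_pow (by omega), mul_zero, add_zero, mul_sum]
  congr 1
  refine sum_congr rfl fun l _ => ?_
  rw [Nat.cast_sub hi.le]
  ring

theorem tan_deriv_even_leading_coeff (n : ℕ) (hn : 1 ≤ n) (x : ℝ) (hx : Real.cos x ≠ 0) :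
    iteratedDeriv (2 * n) Real.tan x * Real.cos x ^ (2 * n + 1)
      - ∑ i ∈ Finset.range (n - 1),
          (2 * ∑ l ∈ Finset.range (n - i),
            (-1 : ℝ) ^ (i + l) * (Nat.choose (2 * n + 1) l : ℝ)
              * ((n : ℝ) - i - l) ^ (2 * n)) * Real.sin ((2 * (i : ℝ) + 1) * x)
    = (-1 : ℝ) ^ (n - 1) * 2 * Real.sin ((2 * (n : ℝ) - 1) * x) := by
  rw [iteratedDeriv_tan _ hx, div_mul_cancel₀ _ (pow_ne_zero _ hx), tanNumerator_two_mul n hn,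
    sum_congr rfl fun i hi => by rw [two_mul_eulerianReal_mid n i (mem_range.mp hi)]]
  obtain ⟨k, rfl⟩ := Nat.exists_eq_add_of_le' hn
  rw [sum_range_succ, Nat.add_sub_cancel, add_sub_cancel_left, Nat.add_sub_cancel_left,
    sum_range_one]
  push_cast
  rw [show (k : ℝ) + 1 - k - 0 = 1 by ring, show 2 * ((k : ℝ) + 1) - 1 = 2 * k + 1 by ring]
  simp only [add_zero, Nat.choose_zero_right, Nat.cast_one, one_pow]
  ring
end
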